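/- arXiv:2302.11390 — 2 statements merged into one kernel-verified Lean document; each statement's English description precedes it below -/
import Mathlib

section
/- Let ε > 0 and let F be a finite graph with at least one edge. For every finite comparability graph G, if t(F,G) ≤ (ε/2)^{χ(F)·α(F)²}, then there exists a spanning subgraph of G that is a comparability graph, is K_{χ(F)}-free (and hence F-free), and is obtained by deleting at most ε·|V(G)|² edges of G. -/
/-- A strict partial order relation: irreflexive and transitive. -/
def IsStrictOrd {α : Type*} (r : α → α → Prop) : Prop :=
  (∀ x, ¬ r x x) ∧ (∀ ⦃x y z⦄, r x y → r y z → r x z)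

/-- A comparability graph: adjacency is comparability in some strict partial order. -/
def IsComparability {V : Type*} (G : SimpleGraph V) : Prop :=
  ∃ r : V → V → Prop, IsStrictOrd r ∧ ∀ x y, G.Adj x y ↔ (r x y ∨ r y x)

/-- A graph homomorphism: every edge of `F` is mapped to an edge of `G`. -/
def IsGraphHom {W V : Type*} (F : SimpleGraph W) (G : SimpleGraph V) (f : W → V) : Prop :=
  ∀ ⦃x y⦄, F.Adj x y → G.Adj (f x) (f y)

/-- The homomorphism density `t(F,G)`: the probability that a uniformly random map from
`V(F)` to `V(G)` is a graph homomorphism. -/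
noncomputable def graphHomDensity {W V : Type*} [Fintype W] [Fintype V]
    (F : SimpleGraph W) (G : SimpleGraph V) : ℝ :=
  (Nat.card {f : W → V // IsGraphHom F G f} : ℝ) / (Fintype.card V : ℝ) ^ (Fintype.card W)

/-- The chromatic number of a finite graph. -/
noncomputable def chromNum {V : Type*} [Fintype V] (G : SimpleGraph V) : ℕ :=
  sInf {n | G.Colorable n}

/-- The independence number of a finite graph. -/
noncomputable def indepNum {V : Type*} [Fintype V] (G : SimpleGraph V) : ℕ :=
  sSup {n | ∃ s : Finset V, s.card = n ∧ ∀ x ∈ s, ∀ y ∈ s, ¬ G.Adj x y}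

/-- `G` is `F`-free: no injective graph homomorphism from `F` to `G`,
i.e. no (not necessarily induced) subgraph isomorphic to `F`. -/
def GraphFreeOf {W V : Type*} (F : SimpleGraph W) (G : SimpleGraph V) : Prop :=
  ¬ ∃ f : W → V, Function.Injective f ∧ IsGraphHom F G f

/-- The number of edges of `G` deleted to obtain the spanning subgraph `G'`. -/
noncomputable def deletedEdges {V : Type*} [Fintype V] (G G' : SimpleGraph V) : ℕ :=
  Nat.card {e : Sym2 V // e ∈ G.edgeSet ∧ e ∉ G'.edgeSet}

lemma natCard_subtype_prod {α β : Type*} [Fintype α] [Finite β] (Q : α → β → Prop) :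
    Nat.card {p : α × β // Q p.1 p.2} = ∑ a, Nat.card {b // Q a b} := by
  rw [Nat.card_congr (Equiv.subtypeProdEquivSigmaSubtype Q), Nat.card_sigma]

lemma natCard_subtype_mono {α : Type*} [Finite α] {P Q : α → Prop} (h : ∀ a, P a → Q a) :
    Nat.card {a // P a} ≤ Nat.card {a // Q a} :=
  Nat.card_le_card_of_injective _ (Subtype.map_injective h Function.injective_id)

/-- The probability that a uniformly random element of `Ω` satisfies `Q`. -/
noncomputable def density {Ω : Type*} (Q : Ω → Prop) : ℝ :=
  (Nat.card {ω // Q ω} : ℝ) / Nat.card Ω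

lemma density_nonneg {Ω : Type*} (Q : Ω → Prop) : 0 ≤ density Q := by
  unfold density; positivity

lemma density_mono {Ω : Type*} [Finite Ω] {Q Q' : Ω → Prop} (h : ∀ ω, Q ω → Q' ω) :
    density Q ≤ density Q' := by
  unfold density
  gcongr
  exact natCard_subtype_mono h

lemma density_equiv {Ω Ω' : Type*} (e : Ω ≃ Ω') (Q : Ω' → Prop) :
    density (fun ω => Q (e ω)) = density Q := by
  unfold density
  rw [Nat.card_congr e, Nat.card_congr (e.subtypeEquiv (q := Q) fun _ => Iff.rfl)]

lemma density_fst {Ω Z : Type*} [Finite Z] [Nonempty Z] (Q : Ω → Prop) :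
    density (fun p : Ω × Z => Q p.1) = density Q := by
  unfold density
  rw [Nat.card_congr Equiv.prodSubtypeFstEquivSubtypeProd, Nat.card_prod, Nat.card_prod]
  have : (Nat.card Z : ℝ) ≠ 0 := by exact_mod_cast Nat.card_pos.ne'
  push_cast
  exact mul_div_mul_right _ _ this

/-- Restricting a uniformly random map along an injection yields a uniformly random map. -/
lemma density_comp_injective {U W V : Type*} [Finite U] [Finite V] [Nonempty V]
    {ι : W → U} (hι : Function.Injective ι) (Q : (W → V) → Prop) :
    density (fun g : U → V => Q (g ∘ ι)) = density Q := by
  classical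
  let e : (U → V) ≃ (W → V) × ({u // ¬ u ∈ Set.range ι} → V) :=
    (Equiv.piEquivPiSubtypeProd (· ∈ Set.range ι) fun _ => V).trans
      (((Equiv.ofInjective ι hι).symm.arrowCongr (Equiv.refl V)).prodCongr (Equiv.refl _))
  rw [← density_fst (Z := {u // ¬ u ∈ Set.range ι} → V) Q, ← density_equiv e]
  rfl

/-- Blowing up the right-hand side of a bipartite relation, by convexity. -/
lemma density_pow_le_density_blowup_right {X Y : Type*} [Fintype X] [Fintype Y]
    [Nonempty X] [Nonempty Y] (R : X → Y → Prop) (a : ℕ) :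
    density (fun p : X × Y => R p.1 p.2) ^ a ≤
      density (fun p : X × (Fin a → Y) => ∀ i, R p.1 (p.2 i)) := by
  have hX : (0 : ℝ) < Nat.card X := by exact_mod_cast Nat.card_pos
  have hY : (0 : ℝ) < Nat.card Y := by exact_mod_cast Nat.card_pos
  unfold density
  rw [natCard_subtype_prod R, natCard_subtype_prod fun x (y : Fin a → Y) => ∀ i, R x (y i)]
  have hpow : ∀ x, Nat.card {y : Fin a → Y // ∀ i, R x (y i)} = Nat.card {y // R x y} ^ a := by
    intro x
    rw [Nat.card_congr (Equiv.subtypePiEquivPi (p := fun (_ : Fin a) y => R x y)), Nat.card_fun,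
      Nat.card_fin]
  simp only [hpow, Nat.card_prod, Nat.card_fun, Nat.card_fin]
  push_cast
  rw [div_pow, div_le_div_iff₀ (by positivity) (by positivity)]
  rcases a with _ | a
  · simp
  have key := pow_sum_div_card_le_sum_pow (s := Finset.univ)
    (f := fun x : X => (Nat.card {y // R x y} : ℝ)) (fun _ _ => by positivity) a
  rw [Finset.card_univ, ← Nat.card_eq_fintype_card, div_le_iff₀ (by positivity)] at key
  calc _ ≤ _ := mul_le_mul_of_nonneg_right key (by positivity)
    _ = _ := by ring

lemma density_pow_le_density_blowup {X Y : Type*} [Fintype X] [Fintype Y]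
    [Nonempty X] [Nonempty Y] (R : X → Y → Prop) (a : ℕ) :
    density (fun p : X × Y => R p.1 p.2) ^ a ^ 2 ≤
      density (fun p : (Fin a → X) × (Fin a → Y) => ∀ i j, R (p.1 i) (p.2 j)) := by
  have h1 := density_pow_le_density_blowup_right R a
  have h2 := density_pow_le_density_blowup_right
    (fun (y : Fin a → Y) x => ∀ j, R x (y j)) a
  have e1 := density_equiv (Equiv.prodComm (Fin a → Y) X) fun p => ∀ j, R p.1 (p.2 j)
  have e2 := density_equiv (Equiv.prodComm (Fin a → Y) (Fin a → X))
    fun p => ∀ i j, R (p.1 i) (p.2 j)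
  simp only [Equiv.prodComm_apply, Prod.fst_swap, Prod.snd_swap] at e1 e2
  rw [e1, e2] at h2
  rw [pow_two, pow_mul]
  exact (pow_le_pow_left₀ (pow_nonneg (density_nonneg _) a) h1 a).trans h2

/-- The entries of `x` are consecutively decreasing for `r`. -/
def IsDescending {V : Type*} (r : V → V → Prop) {m : ℕ} (x : Fin (m + 1) → V) : Prop :=
  ∀ i : Fin m, r (x i.succ) (x i.castSucc)

/-- The `i`-th set of a decreasing sequence: the first consists of all vertices, and each further
one of the vertices lying above at least `d` members of the previous one. -/
def IsRich {V : Type*} (r : V → V → Prop) (d : ℝ) : ℕ → V → Prop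
  | 0, _ => True
  | i + 1, v => d ≤ Nat.card {u // r u v ∧ IsRich r d i u}

lemma IsRich.of_succ {V : Type*} [Finite V] {r : V → V → Prop} {d : ℝ} {i : ℕ} {v : V}
    (h : IsRich r d (i + 1) v) : IsRich r d i v := by
  induction i generalizing v with
  | zero => trivial
  | succ i ih =>
    exact le_trans (α := ℝ) h
      (Nat.cast_le.2 (natCard_subtype_mono fun u hu => ⟨hu.1, ih hu.2⟩))

lemma IsRich.anti {V : Type*} [Finite V] {r : V → V → Prop} {d : ℝ} {i j : ℕ} {v : V}
    (hij : i ≤ j) (h : IsRich r d j v) : IsRich r d i v := by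
  induction hij with
  | refl => exact h
  | step _ ih => exact ih h.of_succ

lemma IsRich.of_rel {V : Type*} [Finite V] {r : V → V → Prop} (hr : IsStrictOrd r) {d : ℝ} {i : ℕ}
    {u v : V} (huv : r u v) (h : IsRich r d i u) : IsRich r d i v := by
  cases i with
  | zero => trivial
  | succ i =>
    exact le_trans (α := ℝ) h
      (Nat.cast_le.2 (natCard_subtype_mono fun w hw => ⟨hr.2 hw.1 huv, hw.2⟩))

lemma isDescending_cons_cons {V : Type*} {r : V → V → Prop} {m : ℕ} (v u : V) (x : Fin m → V) :
    IsDescending r (Fin.cons v (Fin.cons u x : Fin (m + 1) → V) : Fin (m + 2) → V) ↔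
      r u v ∧ IsDescending r (Fin.cons u x : Fin (m + 1) → V) := by
  unfold IsDescending
  rw [Fin.forall_fin_succ]
  rfl

lemma card_mul_le_sum {V : Type*} [Fintype V] (P : V → Prop) (f : V → ℕ) {b : ℝ}
    (h : ∀ v, P v → b ≤ f v) : (Nat.card {v // P v} : ℝ) * b ≤ ((∑ v, f v : ℕ) : ℝ) := by
  classical
  rw [Nat.card_eq_fintype_card, Fintype.card_subtype, ← nsmul_eq_mul]
  push_cast
  refine (Finset.card_nsmul_le_sum _ (fun v => (f v : ℝ)) b ?_).trans
    (Finset.sum_le_sum_of_subset_of_nonneg (Finset.filter_subset _ _) fun _ _ _ => by positivity)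
  intro v hv
  exact h v (Finset.mem_filter.1 hv).2

lemma IsRich.pow_le_card {V : Type*} [Fintype V] {r : V → V → Prop} {d : ℝ} (hd : 0 ≤ d) {m : ℕ}
    {v : V} (h : IsRich r d m v) :
    d ^ m ≤ Nat.card {x : Fin m → V // IsDescending r (Fin.cons v x : Fin (m + 1) → V)} := by
  induction m generalizing v with
  | zero =>
    have : Nonempty {x : Fin 0 → V // IsDescending r (Fin.cons v x : Fin 1 → V)} :=
      ⟨⟨Fin.elim0, fun i => i.elim0⟩⟩
    have : 0 < Nat.card {x : Fin 0 → V // IsDescending r (Fin.cons v x : Fin 1 → V)} :=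
      Nat.card_pos
    rw [pow_zero]
    exact_mod_cast this
  | succ m ih =>
    let e := Fin.consEquiv (n := m) fun _ => V
    have hcard : Nat.card {x : Fin (m + 1) → V // IsDescending r (Fin.cons v x : Fin (m + 2) → V)}
        = ∑ u, Nat.card {x : Fin m → V //
            r u v ∧ IsDescending r (Fin.cons u x : Fin (m + 1) → V)} := by
      rw [← natCard_subtype_prod]
      exact (Nat.card_congr (e.subtypeEquiv fun p => (isDescending_cons_cons v p.1 p.2).symm)).symm
    rw [hcard, pow_succ']
    refine (mul_le_mul_of_nonneg_right h (by positivity)).trans (card_mul_le_sum _ _ ?_)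
    rintro u ⟨huv, hu⟩
    simpa [huv] using ih hu

lemma card_isRich_mul_le {V : Type*} [Fintype V] (r : V → V → Prop) {d : ℝ} (hd : 0 ≤ d) (m : ℕ) :
    (Nat.card {v // IsRich r d m v} : ℝ) * d ^ m ≤
      Nat.card {x : Fin (m + 1) → V // IsDescending r x} := by
  let e := Fin.consEquiv (n := m) fun _ => V
  have hcard : Nat.card {x : Fin (m + 1) → V // IsDescending r x} =
      ∑ v, Nat.card {x : Fin m → V // IsDescending r (Fin.cons v x : Fin (m + 1) → V)} := by
    rw [← natCard_subtype_prod]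
    exact (Nat.card_congr (e.subtypeEquiv fun p => Iff.rfl)).symm
  rw [hcard]
  exact card_mul_le_sum _ _ fun v hv => hv.pow_le_card hd

/-- The subrelation of `r` between vertices of different richness levels below `m`. -/
def LevelRel {V : Type*} (r : V → V → Prop) (d : ℝ) (m : ℕ) (u v : V) : Prop :=
  r u v ∧ ¬ IsRich r d m v ∧ ∃ i < m, IsRich r d i v ∧ ¬ IsRich r d i u

lemma LevelRel.isStrictOrd {V : Type*} [Finite V] {r : V → V → Prop} (hr : IsStrictOrd r) (d : ℝ)
    (m : ℕ) : IsStrictOrd (LevelRel r d m) := by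
  refine ⟨fun x h => hr.1 x h.1, ?_⟩
  rintro x y z ⟨hxy, -, i, hi, hyi, hxi⟩ ⟨hyz, hz, -⟩
  exact ⟨hr.2 hxy hyz, hz, i, hi, hyi.of_rel hr hyz, hxi⟩

lemma card_rel_not_levelRel_le {V : Type*} [Finite V] (r : V → V → Prop) {d : ℝ} {m : ℕ}
    {v : V} (hv : ¬ IsRich r d m v) :
    (Nat.card {u // r u v ∧ ¬ LevelRel r d m u v} : ℝ) ≤ d := by
  classical
  set j := Nat.findGreatest (IsRich r d · v) m with hj
  have hjv : IsRich r d j v :=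
    Nat.findGreatest_spec (P := (IsRich r d · v)) (Nat.zero_le m) trivial
  have hjm : j < m := (Nat.findGreatest_le m).lt_of_ne fun h => hv (h ▸ hjv)
  have hj' : ¬ IsRich r d (j + 1) v :=
    Nat.findGreatest_is_greatest (P := (IsRich r d · v)) (Nat.lt_succ_self j) hjm
  refine le_trans ?_ (not_le.1 (show ¬ d ≤ _ from hj')).le
  refine Nat.cast_le.2 (natCard_subtype_mono fun u hu => ⟨hu.1, ?_⟩)
  by_contra hju
  exact hu.2 ⟨hu.1, hv, j, hjm, hjv, hju⟩

lemma sum_card_rel_not_levelRel_le {V : Type*} [Fintype V] (r : V → V → Prop) {d : ℝ} (hd : 0 ≤ d)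
    {m : ℕ} (hm : (Nat.card {v // IsRich r d m v} : ℝ) ≤ d) :
    (Nat.card {p : V × V // r p.2 p.1 ∧ ¬ LevelRel r d m p.2 p.1} : ℝ) ≤
      2 * d * Fintype.card V := by
  classical
  rw [natCard_subtype_prod fun v u => r u v ∧ ¬ LevelRel r d m u v]
  push_cast
  calc ∑ v, (Nat.card {u // r u v ∧ ¬ LevelRel r d m u v} : ℝ)
      ≤ ∑ v, ((if IsRich r d m v then (Fintype.card V : ℝ) else 0) + d) := by
        refine Finset.sum_le_sum fun v _ => ?_
        split_ifs with hv
        · have : (Nat.card {u // r u v ∧ ¬ LevelRel r d m u v} : ℝ) ≤ Fintype.card V := by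
            rw [← Nat.card_eq_fintype_card]
            exact_mod_cast Nat.card_le_card_of_injective _ Subtype.val_injective
          linarith
        · rw [zero_add]
          exact card_rel_not_levelRel_le r hv
    _ = (Nat.card {v // IsRich r d m v} : ℝ) * Fintype.card V + Fintype.card V * d := by
        rw [Finset.sum_add_distrib, ← Finset.sum_filter, Nat.card_eq_fintype_card,
          Fintype.card_subtype]
        simp
    _ ≤ d * Fintype.card V + Fintype.card V * d := by gcongr
    _ = 2 * d * Fintype.card V := by ring

/-- The comparability graph of a strict partial order. -/
def comparabilityGraph {V : Type*} (r : V → V → Prop) (hr : IsStrictOrd r) : SimpleGraph V where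
  Adj x y := r x y ∨ r y x
  symm := ⟨fun _ _ h => h.symm⟩
  loopless := ⟨fun x h => h.elim (hr.1 x) (hr.1 x)⟩

lemma levelRel_colorable {V : Type*} [Finite V] {r : V → V → Prop} (hr : IsStrictOrd r) (d : ℝ)
    {m : ℕ} (hm : 0 < m) :
    (comparabilityGraph _ (LevelRel.isStrictOrd hr d m)).Colorable m := by
  classical
  let c : V → ℕ := fun v => Nat.findGreatest (IsRich r d · v) (m - 1)
  have hc : ∀ v, IsRich r d (c v) v := fun v =>
    Nat.findGreatest_spec (P := (IsRich r d · v)) (Nat.zero_le (m - 1)) trivial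
  have hlt : ∀ v, c v < m := fun v => by
    have : c v ≤ m - 1 := Nat.findGreatest_le _
    omega
  have hne : ∀ u v, LevelRel r d m u v → c u ≠ c v := by
    rintro u v ⟨-, -, i, him, hiv, hiu⟩ h
    have : i ≤ c v := Nat.le_findGreatest (P := (IsRich r d · v)) (by omega) hiv
    exact hiu ((hc u).anti (h ▸ this))
  let C : V → Fin m := fun v => ⟨c v, hlt v⟩
  refine ⟨SimpleGraph.Coloring.mk C ?_⟩
  rintro u v (h | h) he
  · exact hne u v h (Fin.mk.inj_iff.1 he)
  · exact hne v u h (Fin.mk.inj_iff.1 he).symm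

lemma deletedEdges_comparabilityGraph_le {V : Type*} [Fintype V] {G : SimpleGraph V}
    {r s : V → V → Prop} (hG : ∀ x y, G.Adj x y ↔ (r x y ∨ r y x)) (hs : IsStrictOrd s) :
    deletedEdges G (comparabilityGraph s hs) ≤
      Nat.card {p : V × V // r p.2 p.1 ∧ ¬ s p.2 p.1} := by
  unfold deletedEdges
  change Set.ncard {e : Sym2 V | _} ≤ Set.ncard {p : V × V | r p.2 p.1 ∧ ¬ s p.2 p.1}
  refine le_trans (Set.ncard_le_ncard ?_ (Set.toFinite _))
    (Set.ncard_image_le (f := fun p : V × V => s(p.1, p.2)) (Set.toFinite _))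
  intro e
  induction e with
  | _ x y =>
    rintro ⟨h, h'⟩
    have h' : ¬ (s x y ∨ s y x) := h'
    rw [not_or] at h'
    rcases (hG x y).1 h with h | h
    · exact ⟨(y, x), ⟨h, h'.1⟩, Sym2.eq_swap⟩
    · exact ⟨(x, y), ⟨h, h'.2⟩, rfl⟩

/-- Take the entries of `x` at even places and those of `y` at odd places. -/
def interleave {V : Type*} {k : ℕ} (x y : Fin k → V) (i : Fin k) : V :=
  if Even (i : ℕ) then x i else y i

lemma density_interleave {V : Type*} [Finite V] [Nonempty V] {k : ℕ} (Q : (Fin k → V) → Prop) :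
    density (fun p : (Fin k → V) × (Fin k → V) => Q (interleave p.1 p.2)) = density Q := by
  let ι : Fin k → Fin k ⊕ Fin k := fun i => if Even (i : ℕ) then .inl i else .inr i
  have hι : Function.Injective ι := by
    intro i j h
    simp only [ι] at h
    split_ifs at h <;> simpa using h
  rw [← density_comp_injective hι Q,
    ← density_equiv (Equiv.sumArrowEquivProdArrow (Fin k) (Fin k) V)]
  congr 1
  ext g
  congr! 1
  ext i
  simp only [interleave, ι, Function.comp]
  split_ifs <;> rfl

/-- In a blow-up of a descending sequence, vertices in different parts are comparable. -/
lemma rel_of_interleave_isDescending {V : Type*} {r : V → V → Prop} (hr : IsStrictOrd r)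
    {a m : ℕ} {x y : Fin a → Fin (m + 1) → V}
    (h : ∀ s t, IsDescending r (interleave (x s) (y t))) (i j : Fin (m + 1)) (hij : i < j)
    (s t : Fin a) : r (interleave (x t) (y t) j) (interleave (x s) (y s) i) := by
  have hstep : ∀ (i : Fin m) (s t : Fin a),
      r (interleave (x t) (y t) i.succ) (interleave (x s) (y s) i.castSucc) := by
    intro i s t
    by_cases hi : Even (i : ℕ)
    · have hi' : ¬ Even ((i : ℕ) + 1) := by simpa [Nat.even_add_one] using hi
      simpa [interleave, hi, hi'] using h s t i
    · have hi' : Even ((i : ℕ) + 1) := by simpa [Nat.even_add_one] using hi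
      simpa [interleave, hi, hi'] using h t s i
  induction j using Fin.induction generalizing t with
  | zero => exact absurd hij (Fin.not_lt_zero i)
  | succ j ih =>
    rcases (Fin.le_castSucc_iff.2 hij).eq_or_lt with rfl | hlt
    · exact hstep j s t
    · exact hr.2 (hstep j t t) (ih hlt t)

lemma graphHomDensity_eq_density {W V : Type*} [Fintype W] [Fintype V]
    (F : SimpleGraph W) (G : SimpleGraph V) :
    graphHomDensity F G = density (IsGraphHom F G) := by
  simp [graphHomDensity, density, Nat.card_fun]

lemma colorable_chromNum {W : Type*} [Fintype W] (F : SimpleGraph W) :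
    F.Colorable (chromNum F) :=
  Nat.sInf_mem (s := {n | F.Colorable n}) ⟨_, F.colorable_of_fintype⟩

lemma card_le_indepNum {W : Type*} [Fintype W] (F : SimpleGraph W) (s : Finset W)
    (hs : ∀ x ∈ s, ∀ y ∈ s, ¬ F.Adj x y) : s.card ≤ indepNum F := by
  refine le_csSup ⟨Fintype.card W, ?_⟩ ⟨s, rfl, hs⟩
  rintro _ ⟨t, rfl, -⟩
  exact t.card_le_univ

lemma exists_injOn_colorClass {W : Type*} [Fintype W] (F : SimpleGraph W) {k : ℕ}
    (c : F.Coloring (Fin k)) :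
    ∃ e : W → Fin (indepNum F), ∀ v w, c v = c w → e v = e w → v = w := by
  classical
  have he : ∀ i, Nonempty ({w // c w = i} ↪ Fin (indepNum F)) := fun i => by
    apply Function.Embedding.nonempty_of_card_le
    rw [Fintype.card_subtype, Fintype.card_fin]
    refine card_le_indepNum F _ fun x hx y hy hxy => c.valid hxy ?_
    rw [(Finset.mem_filter.1 hx).2, (Finset.mem_filter.1 hy).2]
  let E := fun i => (he i).some
  refine ⟨fun w => E (c w) ⟨w, rfl⟩, fun v w hc h => ?_⟩
  have hw : ∀ (i) (hi : c w = i), E (c w) ⟨w, rfl⟩ = E i ⟨w, hi⟩ := by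
    rintro _ rfl
    rfl
  simpa using (E (c v)).injective (h.trans (hw _ hc.symm))

/-- Homomorphism counts into a comparability graph are controlled by those of chains. -/
lemma density_isDescending_pow_le {W V : Type*} [Fintype W] [Fintype V] [Nonempty V]
    (F : SimpleGraph W) {G : SimpleGraph V} {r : V → V → Prop} (hr : IsStrictOrd r)
    (hG : ∀ x y, G.Adj x y ↔ (r x y ∨ r y x)) {m : ℕ} (hF : F.Colorable (m + 1)) :
    density (IsDescending r (m := m)) ^ indepNum F ^ 2 ≤ graphHomDensity F G := by
  obtain ⟨c⟩ := hF
  obtain ⟨e, he⟩ := exists_injOn_colorClass F c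
  generalize indepNum F = a at e he
  let ι : W → (Fin a × Fin (m + 1)) ⊕ (Fin a × Fin (m + 1)) := fun w =>
    if Even (c w : ℕ) then .inl (e w, c w) else .inr (e w, c w)
  have hι : Function.Injective ι := by
    intro v w h
    simp only [ι] at h
    split_ifs at h <;> simp at h <;> exact he v w h.2 h.1
  rw [graphHomDensity_eq_density, ← density_interleave (IsDescending r),
    ← density_comp_injective hι (IsGraphHom F G)]
  let E : ((Fin a × Fin (m + 1)) ⊕ (Fin a × Fin (m + 1)) → V) ≃
      (Fin a → Fin (m + 1) → V) × (Fin a → Fin (m + 1) → V) :=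
    (Equiv.sumArrowEquivProdArrow _ _ V).trans
      ((Equiv.curry _ _ V).prodCongr (Equiv.curry _ _ V))
  let B : (Fin a → Fin (m + 1) → V) × (Fin a → Fin (m + 1) → V) → Prop :=
    fun p => ∀ s t, IsDescending r (interleave (p.1 s) (p.2 t))
  refine (density_pow_le_density_blowup (fun x y => IsDescending r (interleave x y)) a).trans ?_
  change density B ≤ _
  rw [← density_equiv E B]
  refine density_mono fun g hg v w hvw => ?_
  have hval : ∀ w, (g ∘ ι) w = interleave ((E g).1 (e w)) ((E g).2 (e w)) (c w) := by
    intro w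
    simp only [interleave, ι, Function.comp]
    split_ifs <;> rfl
  rw [hG, hval, hval]
  rcases lt_or_gt_of_ne (c.valid hvw) with h | h
  · exact .inr (rel_of_interleave_isDescending hr hg _ _ h _ _)
  · exact .inl (rel_of_interleave_isDescending hr hg _ _ h _ _)

lemma indepNum_pos {W : Type*} [Fintype W] (F : SimpleGraph W) [Nonempty W] : 0 < indepNum F := by
  obtain ⟨w⟩ := ‹Nonempty W›
  exact card_le_indepNum F {w} (by simp)

/-- **Polynomial removal lemma for comparability graphs** (Theorem 9).
If `F` has an edge and `t(F,G) ≤ (ε/2)^{χ(F)·α(F)²}` for a comparability graph `G`, then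
there is a `K_{χ(F)}`-free (hence `F`-free) spanning subgraph of `G` that is a comparability
graph, obtained by deleting at most `ε·|V(G)|²` edges. -/
theorem comparability_removal_lemma {W V : Type*} [Fintype W] [Fintype V]
    (F : SimpleGraph W) (G : SimpleGraph V)
    (hF : ∃ x y, F.Adj x y) (hG : IsComparability G)
    (ε : ℝ) (hε : 0 < ε)
    (hdens : graphHomDensity F G ≤ (ε / 2) ^ (chromNum F * (indepNum F) ^ 2)) :
    ∃ G' : SimpleGraph V, G' ≤ G ∧ IsComparability G' ∧
      G'.CliqueFree (chromNum F) ∧ GraphFreeOf F G' ∧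
      (deletedEdges G G' : ℝ) ≤ ε * (Fintype.card V : ℝ) ^ 2 := by
  classical
  obtain ⟨r, hr, hGr⟩ := hG
  obtain ⟨m, hm, hk⟩ : ∃ m, 0 < m ∧ chromNum F = m + 1 := by
    obtain ⟨x, y, hxy⟩ := hF
    obtain ⟨c⟩ := colorable_chromNum F
    have hne := Fin.val_ne_of_ne (c.valid hxy)
    exact ⟨chromNum F - 1, by omega, by omega⟩
  have : Nonempty W := ⟨hF.choose⟩
  set n : ℝ := (Fintype.card V : ℝ) with hn
  set d : ℝ := ε / 2 * n with hd
  have hd0 : 0 ≤ d := by positivity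
  have hrich : (Nat.card {v // IsRich r d m v} : ℝ) ≤ d := by
    by_contra! hlt
    have : Nonempty V := by
      by_contra hV
      rw [not_nonempty_iff] at hV
      simp [hd, hn] at hlt
    have hn0 : 0 < n := by simpa [hn] using Fintype.card_pos
    have hchain : (ε / 2) ^ (m + 1) < density (IsDescending r (m := m)) := by
      rw [density, lt_div_iff₀ (by exact_mod_cast Nat.card_pos), Nat.card_fun, Nat.card_fin,
        Nat.card_eq_fintype_card (α := V), Nat.cast_pow, ← hn, ← mul_pow, ← hd, pow_succ']
      exact (mul_lt_mul_of_pos_right hlt (by positivity)).trans_le (card_isRich_mul_le r hd0 m)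
    have hlow := density_isDescending_pow_le F hr hGr (hk ▸ colorable_chromNum F)
    have hlt' := pow_lt_pow_left₀ hchain (by positivity) (pow_pos (indepNum_pos F) 2).ne'
    rw [hk, pow_mul] at hdens
    exact absurd hdens (hlt'.trans_le hlow).not_ge
  have hcol := levelRel_colorable hr d hm
  refine ⟨comparabilityGraph _ (LevelRel.isStrictOrd hr d m), ?_, ?_, ?_, ?_, ?_⟩
  · exact fun x y h => (hGr x y).2 (h.imp (·.1) (·.1))
  · exact ⟨_, LevelRel.isStrictOrd hr d m, fun _ _ => Iff.rfl⟩
  · exact hcol.cliqueFree (by omega)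
  · rintro ⟨f, -, hf⟩
    have : chromNum F ≤ m := Nat.sInf_le (hcol.of_hom ⟨f, fun h => hf h⟩)
    omega
  · calc _ ≤ _ := Nat.cast_le.2 (deletedEdges_comparabilityGraph_le hGr _)
      _ ≤ 2 * d * n := sum_card_rel_not_levelRel_le r hd0 hrich
      _ = ε * n ^ 2 := by rw [hd]; ring
end

section
/- Let χ ≥ 2 be an integer, ε > 0, c > 0, and let G be a finite comparability graph that is ε-far from being K_χ-free, i.e., every spanning subgraph of G obtained by deleting at most ε·|V(G)|² edges contains K_χ. If s = ⌈(4·log(χ) + 4c + 1)/(2ε)⌉ vertices of G are chosen independently and uniformly at random, then with probability at least 1 − e^{−c} there are χ of the chosen vertices that are pairwise adjacent in G (i.e., the sample contains a copy of K_χ). -/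
open Finset

section Levels

variable {V : Type*} [Fintype V]

/-- Iterated robust up-sets of the relation `r`: a vertex lies in level `k + 1` if it has at
least `d` predecessors in level `k`. -/
noncomputable def robustLevel (r : V → V → Prop) (d : ℝ) : ℕ → Finset V
  | 0 => univ
  | k + 1 => by
    classical exact univ.filter fun v =>
      d ≤ ((robustLevel r d k).filter fun u => r u v).card

lemma mem_robustLevel_succ [DecidableEq V] {r : V → V → Prop} [DecidableRel r] {d : ℝ} {k : ℕ}
    {v : V} : v ∈ robustLevel r d (k + 1) ↔
      d ≤ (((robustLevel r d k).filter fun u => r u v).card : ℝ) := by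
  simp only [robustLevel, mem_filter, mem_univ, true_and]
  convert Iff.rfl

lemma robustLevel_upward {r : V → V → Prop} (hr : ∀ ⦃x y z⦄, r x y → r y z → r x z) {d : ℝ}
    {k : ℕ} {v w : V} (hv : v ∈ robustLevel r d k) (hvw : r v w) : w ∈ robustLevel r d k := by
  classical
  cases k with
  | zero => simp [robustLevel]
  | succ k =>
    rw [mem_robustLevel_succ] at hv ⊢
    refine hv.trans ?_
    exact_mod_cast card_le_card (monotone_filter_right _ fun u _ hu => hr hu hvw)

/-- The first `k` such that `v` is not in the robust level `k + 1`. -/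
noncomputable def levelIndex (r : V → V → Prop) (d : ℝ) (v : V) : ℕ :=
  sInf {k | v ∉ robustLevel r d (k + 1)}

lemma mem_robustLevel_levelIndex (r : V → V → Prop) (d : ℝ) (v : V) :
    v ∈ robustLevel r d (levelIndex r d v) := by
  rcases h : levelIndex r d v with _ | k
  · simp [robustLevel]
  · by_contra hv
    have : levelIndex r d v ≤ k := Nat.sInf_le hv
    omega

lemma notMem_robustLevel_levelIndex_succ {r : V → V → Prop} {d : ℝ} {v : V} {k : ℕ}
    (hv : v ∉ robustLevel r d (k + 1)) :
    v ∉ robustLevel r d (levelIndex r d v + 1) :=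
  Nat.sInf_mem (s := {k | v ∉ robustLevel r d (k + 1)}) ⟨k, hv⟩

end Levels

section Sampling

variable {V ι : Type*}

/-- The values of `f` contain an `r`-chain of length `k` all of whose elements precede `v`. -/
def HasChainBelow (r : V → V → Prop) (f : ι → V) : ℕ → V → Prop
  | 0, _ => True
  | k + 1, v => ∃ i, r (f i) v ∧ HasChainBelow r f k (f i)

lemma HasChainBelow.exists_chain {r : V → V → Prop} (hr : ∀ ⦃x y z⦄, r x y → r y z → r x z)
    {f : ι → V} {k : ℕ} {v : V} (h : HasChainBelow r f k v) :
    ∃ g : Fin k → ι, (∀ i, r (f (g i)) v) ∧ ∀ i j, i < j → r (f (g j)) (f (g i)) := by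
  induction k generalizing v with
  | zero => exact ⟨Fin.elim0, fun i => i.elim0, fun i => i.elim0⟩
  | succ k ih =>
    obtain ⟨a, hav, ha⟩ := h
    obtain ⟨g, hg, hg'⟩ := ih ha
    refine ⟨Fin.cons a g, fun i => ?_, fun i j hij => ?_⟩
    · cases i using Fin.cases with
      | zero => simpa using hav
      | succ i => simpa using hr (hg i) hav
    · cases j using Fin.cases with
      | zero => exact absurd hij (Fin.not_lt_zero i)
      | succ j =>
        cases i using Fin.cases with
        | zero => simpa using hg j
        | succ i => simpa using hg' i j (by simpa using hij)

variable [Fintype V] [DecidableEq V] [Fintype ι] [LinearOrder ι]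

/-- The restriction of the boxes `C` expressing that coordinate `j` takes the value `v` and that
every coordinate in `I` hitting `T` has a smaller key than `(ρ v, j)`. -/
def topBox (ρ : V → ℕ) (I : Finset ι) (C : ι → Finset V) (T : Finset V) (v : V) (j : ι) (i : ι) :
    Finset V :=
  if i = j then {v}
  else if i ∈ I then (C i).filter fun x => x ∈ T → toLex (ρ x, i) < toLex (ρ v, j)
  else C i

variable {ρ : V → ℕ} {I : Finset ι} {C : ι → Finset V} {T : Finset V}

omit [Fintype V] in
lemma topBox_pairwiseDisjoint :
    ((T ×ˢ I : Finset (V × ι)) : Set (V × ι)).PairwiseDisjoint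
      fun p => Fintype.piFinset (topBox ρ I C T p.1 p.2) := by
  rintro ⟨v, j⟩ hp ⟨w, l⟩ hq hne
  simp only [coe_product, Set.mem_prod, mem_coe] at hp hq
  rw [Function.onFun, Finset.disjoint_left]
  intro f hf hf'
  rw [Fintype.mem_piFinset] at hf hf'
  have hv : f j = v := by simpa [topBox] using hf j
  have hw : f l = w := by simpa [topBox] using hf' l
  by_cases hjl : j = l
  · subst hjl
    exact hne (by rw [← hv, ← hw])
  · have h1 := hf l
    have h2 := hf' j
    simp only [topBox, Ne.symm hjl, hjl, if_false, hp.2, hq.2, if_true, mem_filter, hv, hw] at h1 h2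
    exact lt_asymm (h1.2 hq.1) (h2.2 hp.1)

omit [Fintype V] in
lemma sum_prod_topBox_le (hT : ∀ i ∈ I, T ⊆ C i) :
    ∑ p ∈ T ×ˢ I, ∏ i, (topBox ρ I C T p.1 p.2 i).card ≤ ∏ i, (C i).card := by
  simp only [← Fintype.card_piFinset]
  rw [← card_biUnion topBox_pairwiseDisjoint]
  refine card_le_card (biUnion_subset.2 fun p hp => Fintype.piFinset_subset _ _ fun i => ?_)
  rw [mem_product] at hp
  unfold topBox
  split_ifs with h1 h2
  · exact singleton_subset_iff.2 (hT i (h1 ▸ hp.2) hp.1)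
  · exact filter_subset _ _
  · exact Subset.rfl

omit [Fintype V] in
lemma exists_mem_topBox {f : ι → V} (hf : f ∈ Fintype.piFinset C)
    (hit : ∃ i ∈ I, f i ∈ T) :
    ∃ p ∈ T ×ˢ I, f ∈ Fintype.piFinset (topBox ρ I C T p.1 p.2) ∧ f p.2 = p.1 := by
  obtain ⟨i₀, hi₀, hfi₀⟩ := hit
  obtain ⟨j, hj, hmax⟩ := exists_max_image (I.filter fun i => f i ∈ T)
    (fun i => toLex (ρ (f i), i)) ⟨i₀, mem_filter.2 ⟨hi₀, hfi₀⟩⟩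
  rw [mem_filter] at hj
  refine ⟨(f j, j), mem_product.2 ⟨hj.2, hj.1⟩, ?_, rfl⟩
  rw [Fintype.mem_piFinset] at hf ⊢
  intro i
  unfold topBox
  split_ifs with h1 h2
  · simp [h1]
  · refine mem_filter.2 ⟨hf i, fun hi => lt_of_le_of_ne (hmax i (mem_filter.2 ⟨h2, hi⟩)) ?_⟩
    intro h
    exact h1 (congrArg Prod.snd (toLex.injective h))
  · exact hf i

omit [LinearOrder ι] in
lemma card_miss_le [DecidableEq ι] {q : ℝ} (hq : q ≤ 1)
    (hT : ∀ i ∈ I, T ⊆ C i) (hcard : (1 - q) * Fintype.card V ≤ T.card) :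
    (((Fintype.piFinset C).filter fun f => ∀ i ∈ I, f i ∉ T).card : ℝ) ≤
      (∏ i, ((C i).card : ℝ)) * q ^ I.card := by
  have hsub : ((Fintype.piFinset C).filter fun f => ∀ i ∈ I, f i ∉ T) ⊆
      Fintype.piFinset fun i => if i ∈ I then C i \ T else C i := by
    intro f hf
    rw [mem_filter, Fintype.mem_piFinset] at hf
    rw [Fintype.mem_piFinset]
    intro i
    split_ifs with h
    · exact mem_sdiff.2 ⟨hf.1 i, hf.2 i h⟩
    · exact hf.1 i
  calc (((Fintype.piFinset C).filter fun f => ∀ i ∈ I, f i ∉ T).card : ℝ)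
      ≤ ∏ i, ((if i ∈ I then C i \ T else C i).card : ℝ) := by
        have := card_le_card hsub
        rw [Fintype.card_piFinset] at this
        exact_mod_cast this
    _ ≤ ∏ i, (((C i).card : ℝ) * if i ∈ I then q else 1) := by
        refine prod_le_prod (fun i _ => by positivity) fun i _ => ?_
        split_ifs with h
        · rw [cast_card_sdiff (hT i h)]
          have h1 : ((C i).card : ℝ) ≤ Fintype.card V := by exact_mod_cast card_le_univ _
          nlinarith
        · simp
    _ = (∏ i, ((C i).card : ℝ)) * q ^ I.card := by
        rw [prod_mul_distrib, prod_ite_mem, univ_inter, prod_const]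

open Classical in
/-- The number of maps in a product of boxes containing no chain of length `k + 1` with top
element in the large set `T` of the robust level `k`. -/
lemma card_no_chain_le {r : V → V → Prop} (hr : ∀ ⦃x y z⦄, r x y → r y z → r x z)
    (hρ : ∀ x y, r x y → ρ x < ρ y) {q : ℝ} (hq0 : 0 ≤ q) (hq : q ≤ 1) (k : ℕ)
    (I : Finset ι) (C : ι → Finset V) (T : Finset V)
    (hTk : T ⊆ robustLevel r ((1 - q) * Fintype.card V) k)
    (hcard : (1 - q) * Fintype.card V ≤ T.card)
    (hT : ∀ i ∈ I, T ⊆ C i) (hlow : ∀ i ∈ I, ∀ x ∈ T, ∀ y, r y x → y ∈ C i) :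
    (((Fintype.piFinset C).filter fun f =>
      ¬ ∃ i, f i ∈ T ∧ HasChainBelow r f k (f i)).card : ℝ) ≤
      (∏ i, ((C i).card : ℝ)) * ((k + 1) * q ^ (I.card - k)) := by
  induction k generalizing I C T with
  | zero =>
    simp only [Nat.cast_zero, zero_add, one_mul, Nat.sub_zero]
    refine le_trans ?_ (card_miss_le hq hT hcard)
    refine Nat.cast_le.2 (card_le_card (monotone_filter_right _ fun f _ hf i _ hi => hf ?_))
    exact ⟨i, hi, trivial⟩
  | succ k ih =>
    let D : V → Finset V := fun v =>
      (robustLevel r ((1 - q) * Fintype.card V) k).filter fun u => r u v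
    let F : V × ι → Finset (ι → V) := fun p =>
      (Fintype.piFinset (topBox ρ I C T p.1 p.2)).filter fun f =>
        ¬ ∃ i, f i ∈ D p.1 ∧ HasChainBelow r f k (f i)
    have hF : ∀ p ∈ T ×ˢ I, ((F p).card : ℝ) ≤
        (∏ i, ((topBox ρ I C T p.1 p.2 i).card : ℝ)) * ((k + 1) * q ^ (I.card - (k + 1))) := by
      rintro ⟨v, j⟩ hp
      rw [mem_product] at hp
      have hbelow : ∀ i ∈ I.erase j, ∀ x, r x v → x ∈ topBox ρ I C T v j i := by
        intro i hi x hx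
        rw [mem_erase] at hi
        simp only [topBox, hi.1, hi.2, if_false, if_true, mem_filter]
        exact ⟨hlow i hi.2 v hp.1 x hx, fun _ => Prod.Lex.toLex_lt_toLex.2 (Or.inl (hρ _ _ hx))⟩
      have := ih (I.erase j) (topBox ρ I C T v j) (D v) (filter_subset _ _)
        (mem_robustLevel_succ.1 (hTk hp.1))
        (fun i hi x hx => hbelow i hi x (mem_filter.1 hx).2)
        (fun i hi x hx y hy => hbelow i hi y (hr hy (mem_filter.1 hx).2))
      rwa [card_erase_of_mem hp.2, Nat.sub_sub, add_comm 1 k] at this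
    have hcover : ((Fintype.piFinset C).filter fun f =>
        ¬ ∃ i, f i ∈ T ∧ HasChainBelow r f (k + 1) (f i)) ⊆
        ((Fintype.piFinset C).filter fun f => ∀ i ∈ I, f i ∉ T) ∪ (T ×ˢ I).biUnion F := by
      intro f hf
      rw [mem_filter] at hf
      by_cases hit : ∃ i ∈ I, f i ∈ T
      · obtain ⟨p, hp, hfp, hpv⟩ := exists_mem_topBox (ρ := ρ) hf.1 hit
        refine mem_union_right _ (mem_biUnion.2 ⟨p, hp, mem_filter.2 ⟨hfp, ?_⟩⟩)
        rintro ⟨i, hi, hchain⟩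
        refine hf.2 ⟨p.2, hpv ▸ (mem_product.1 hp).1, i, ?_, hchain⟩
        rw [hpv]
        exact (mem_filter.1 hi).2
      · push Not at hit
        exact mem_union_left _ (mem_filter.2 ⟨hf.1, hit⟩)
    have hprod : 0 ≤ ∏ i, ((C i).card : ℝ) := prod_nonneg fun i _ => Nat.cast_nonneg _
    have hsum : ∑ p ∈ T ×ˢ I, ∏ i, ((topBox ρ I C T p.1 p.2 i).card : ℝ) ≤
        ∏ i, ((C i).card : ℝ) := by
      have h := sum_prod_topBox_le (ρ := ρ) hT
      rw [← Nat.cast_le (α := ℝ), Nat.cast_sum] at h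
      simpa only [Nat.cast_prod] using h
    have hunion := (card_le_card hcover).trans
      ((card_union_le _ _).trans (Nat.add_le_add_left card_biUnion_le _))
    rw [← Nat.cast_le (α := ℝ), Nat.cast_add, Nat.cast_sum] at hunion
    calc _ ≤ (((Fintype.piFinset C).filter fun f => ∀ i ∈ I, f i ∉ T).card : ℝ) +
          ∑ p ∈ T ×ˢ I, ((F p).card : ℝ) := hunion
      _ ≤ (∏ i, ((C i).card : ℝ)) * q ^ (I.card - (k + 1)) +
          (∏ i, ((C i).card : ℝ)) * ((k + 1) * q ^ (I.card - (k + 1))) := by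
          refine add_le_add ((card_miss_le hq hT hcard).trans ?_)
            ((sum_le_sum hF).trans ?_)
          · exact mul_le_mul_of_nonneg_left (pow_le_pow_of_le_one hq0 hq (Nat.sub_le _ _)) hprod
          · rw [← sum_mul]
            exact mul_le_mul_of_nonneg_right hsum (by positivity)
      _ = _ := by push_cast; ring

end Sampling

section Deletion

variable {V : Type*} [Fintype V]

lemma deletedEdges_le_sum {G G' : SimpleGraph V} {P : V → V → Prop} [DecidableRel P]
    (h : ∀ x y, G.Adj x y → ¬ G'.Adj x y → P x y ∨ P y x) :
    deletedEdges G G' ≤ ∑ y, (univ.filter fun x => P x y).card := by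
  classical
  have hsub : {e : Sym2 V | e ∈ G.edgeSet ∧ e ∉ G'.edgeSet} ⊆
      (((univ.filter fun p : V × V => P p.2 p.1).image fun p => s(p.1, p.2) : Finset (Sym2 V)) :
        Set (Sym2 V)) := by
    intro e
    induction e using Sym2.ind with
    | _ x y =>
      rintro ⟨h1, h2⟩
      simp only [coe_image, Set.mem_image, mem_coe, mem_filter, mem_univ, true_and]
      rcases h x y h1 h2 with hP | hP
      · exact ⟨(y, x), hP, Sym2.eq_swap⟩
      · exact ⟨(x, y), hP, rfl⟩
  calc deletedEdges G G' = Set.ncard {e : Sym2 V | e ∈ G.edgeSet ∧ e ∉ G'.edgeSet} := rfl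
    _ ≤ _ := Set.ncard_le_ncard hsub (finite_toSet _)
    _ = _ := Set.ncard_coe_finset _
    _ ≤ (univ.filter fun p : V × V => P p.2 p.1).card := card_image_le
    _ = _ := by
      rw [card_eq_sum_ones, sum_filter, ← univ_product_univ, sum_product]
      simp only [card_eq_sum_ones, sum_filter]

/-- Every graph can be made `m`-colorable by deleting at most `|V|² / (2m)` edges. -/
lemma exists_colorable_deletedEdges_le (G : SimpleGraph V) {m : ℕ} (hm : 0 < m) :
    ∃ G' ≤ G, G'.Colorable m ∧
      (deletedEdges G G' : ℝ) ≤ (Fintype.card V : ℝ) ^ 2 / (2 * m) := by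
  classical
  let e := Fintype.equivFin V
  let G' : SimpleGraph V :=
    { Adj := fun x y => G.Adj x y ∧ (e x : ℕ) % m ≠ (e y : ℕ) % m
      symm := ⟨fun x y h => ⟨h.1.symm, h.2.symm⟩⟩
      loopless := ⟨fun x h => h.2 rfl⟩ }
  refine ⟨G', fun x y h => h.1, ⟨SimpleGraph.Coloring.mk
    (fun v => (⟨(e v : ℕ) % m, Nat.mod_lt _ hm⟩ : Fin m)) fun h => ?_⟩, ?_⟩
  · simpa using h.2
  have hle := deletedEdges_le_sum (G := G) (G' := G')
    (P := fun x y => (e x : ℕ) < e y ∧ (e x : ℕ) % m = (e y : ℕ) % m) (by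
      intro x y hG hG'
      have hmod : (e x : ℕ) % m = (e y : ℕ) % m := by
        by_contra hne
        exact hG' ⟨hG, hne⟩
      have hne : (e x : ℕ) ≠ e y := fun h => hG.ne (e.injective (Fin.ext h))
      rcases lt_or_gt_of_ne hne with h | h
      · exact Or.inl ⟨h, hmod⟩
      · exact Or.inr ⟨h, hmod.symm⟩)
  have hcount : ∀ y, (univ.filter fun x =>
      (e x : ℕ) < e y ∧ (e x : ℕ) % m = (e y : ℕ) % m).card ≤ (e y : ℕ) / m := by
    intro y
    have hc : Nat.count (· ≡ (e y : ℕ) [MOD m]) (e y) = (e y : ℕ) / m := by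
      rw [Nat.count_modEq_card _ hm]
      simp
    rw [← hc, Nat.count_eq_card_filter_range]
    refine card_le_card_of_injOn (fun x => (e x : ℕ)) (fun x hx => ?_) fun x _ y _ h =>
      e.injective (Fin.ext h)
    rw [mem_coe, mem_filter] at hx
    exact mem_coe.2 (mem_filter.2 ⟨mem_range.2 hx.2.1, hx.2.2⟩)
  have hsum : ∑ y, (((e y : ℕ) / m : ℕ) : ℝ) ≤ (Fintype.card V : ℝ) ^ 2 / (2 * m) := by
    calc ∑ y, (((e y : ℕ) / m : ℕ) : ℝ) ≤ ∑ y, ((e y : ℕ) : ℝ) / m :=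
          sum_le_sum fun y _ => Nat.cast_div_le
      _ = (∑ i ∈ range (Fintype.card V), (i : ℝ)) / m := by
          rw [← sum_div, Equiv.sum_comp e (fun i => ((i : ℕ) : ℝ)), Fin.sum_univ_eq_sum_range
            (fun i => (i : ℝ))]
      _ ≤ ((Fintype.card V : ℝ) ^ 2 / 2) / m := by
          gcongr
          have h2 : (∑ i ∈ range (Fintype.card V), i) * 2 ≤ Fintype.card V ^ 2 := by
            rw [sum_range_id_mul_two, pow_two]
            exact Nat.mul_le_mul_left _ (Nat.sub_le _ _)
          have h3 : (∑ i ∈ range (Fintype.card V), (i : ℝ)) * 2 ≤ (Fintype.card V : ℝ) ^ 2 := by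
            rw [← Nat.cast_sum]
            exact_mod_cast h2
          linarith
      _ = _ := by rw [div_div]
  refine le_trans ?_ hsum
  exact_mod_cast hle.trans (sum_le_sum fun y _ => hcount y)

/-- If the robust level `m` is small, a comparability graph can be made `m`-colorable by deleting
few edges. -/
lemma exists_colorable_of_card_robustLevel_le {G : SimpleGraph V} {r : V → V → Prop}
    (hr : ∀ ⦃x y z⦄, r x y → r y z → r x z) (hG : ∀ x y, G.Adj x y ↔ (r x y ∨ r y x))
    {d : ℝ} {m : ℕ} (hm : 0 < m) (hcard : ((robustLevel r d m).card : ℝ) ≤ d) :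
    ∃ G' ≤ G, G'.Colorable m ∧ (deletedEdges G G' : ℝ) ≤ 2 * d * Fintype.card V := by
  classical
  obtain ⟨m, rfl⟩ : ∃ k, m = k + 1 := ⟨m - 1, by omega⟩
  let L := robustLevel r d (m + 1)
  let l := levelIndex r d
  let G' : SimpleGraph V :=
    { Adj := fun x y => G.Adj x y ∧ l x ≠ l y ∧ x ∉ L ∧ y ∉ L
      symm := ⟨fun x y h => ⟨h.1.symm, h.2.1.symm, h.2.2.2, h.2.2.1⟩⟩
      loopless := ⟨fun x h => h.2.1 rfl⟩ }
  have hl : ∀ v, v ∉ L → l v ≤ m := fun v hv => Nat.sInf_le hv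
  refine ⟨G', fun x y h => h.1, ⟨SimpleGraph.Coloring.mk
    (fun v => (⟨min (l v) m, by omega⟩ : Fin (m + 1))) fun {x y} h => ?_⟩, ?_⟩
  · have hx := hl _ h.2.2.1
    have hy := hl _ h.2.2.2
    have hne := h.2.1
    simp only [ne_eq, Fin.mk.injEq, min_eq_left hx, min_eq_left hy]
    exact hne
  have hle := deletedEdges_le_sum (G := G) (G' := G')
    (P := fun x y => r x y ∧ (y ∈ L ∨ l x = l y)) (by
      have key : ∀ x y, r x y → ¬ G'.Adj x y → y ∈ L ∨ l x = l y := by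
        intro x y hxy hn
        by_contra hcon
        push Not at hcon
        exact hn ⟨(hG x y).2 (Or.inl hxy), hcon.2,
          fun hx => hcon.1 (robustLevel_upward hr hx hxy), hcon.1⟩
      intro x y hadj hn
      rcases (hG x y).1 hadj with h | h
      · exact Or.inl ⟨h, key x y h hn⟩
      · exact Or.inr ⟨h, key y x h fun h' => hn h'.symm⟩)
  have hd : 0 ≤ d := le_trans (Nat.cast_nonneg _) hcard
  have hcount : ∀ y, ((univ.filter fun x => r x y ∧ (y ∈ L ∨ l x = l y)).card : ℝ) ≤
      (if y ∈ L then (Fintype.card V : ℝ) else 0) + d := by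
    intro y
    split_ifs with hy
    · have : ((univ.filter fun x => r x y ∧ (y ∈ L ∨ l x = l y)).card : ℝ) ≤ Fintype.card V := by
        exact_mod_cast card_le_univ _
      linarith
    · have hy' := notMem_robustLevel_levelIndex_succ hy
      rw [mem_robustLevel_succ, not_le] at hy'
      rw [zero_add]
      refine le_trans ?_ hy'.le
      refine Nat.cast_le.2 (card_le_card fun x hx => ?_)
      simp only [mem_filter, mem_univ, true_and, hy, false_or] at hx
      refine mem_filter.2 ⟨?_, hx.1⟩
      have hmem := mem_robustLevel_levelIndex r d x
      rwa [show levelIndex r d x = levelIndex r d y from hx.2] at hmem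
  calc (deletedEdges G G' : ℝ)
      ≤ ∑ y, ((univ.filter fun x => r x y ∧ (y ∈ L ∨ l x = l y)).card : ℝ) := by
        exact_mod_cast hle
    _ ≤ ∑ y, ((if y ∈ L then (Fintype.card V : ℝ) else 0) + d) := sum_le_sum fun y _ => hcount y
    _ = L.card * Fintype.card V + Fintype.card V * d := by
        rw [sum_add_distrib, sum_ite_mem, univ_inter, sum_const, sum_const, card_univ]
        simp
    _ ≤ 2 * d * Fintype.card V := by
        have hn : (0 : ℝ) ≤ Fintype.card V := Nat.cast_nonneg _
        have := mul_le_mul_of_nonneg_right hcard hn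
        linarith

end Deletion

lemma mul_pow_sample_le {χ s : ℕ} {ε c : ℝ} (hχ : 2 ≤ χ) (hε : 0 < ε)
    (hq : 0 ≤ 1 - ε / 2) (hχε : 2 * ε * ((χ - 1 : ℕ) : ℝ) ≤ 1)
    (hs : (4 * Real.log χ + 4 * c + 1) / (2 * ε) ≤ s) :
    (χ : ℝ) * (1 - ε / 2) ^ (s - (χ - 1)) ≤ Real.exp (-c) := by
  have hχ0 : (0 : ℝ) < χ := by exact_mod_cast (by omega : 0 < χ)
  have hsub : (s : ℝ) ≤ ((s - (χ - 1) : ℕ) : ℝ) + ((χ - 1 : ℕ) : ℝ) := by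
    exact_mod_cast (by omega : s ≤ s - (χ - 1) + (χ - 1))
  rw [div_le_iff₀ (by positivity)] at hs
  have hexp : Real.log χ + c ≤ ((s - (χ - 1) : ℕ) : ℝ) * (ε / 2) := by nlinarith
  calc (χ : ℝ) * (1 - ε / 2) ^ (s - (χ - 1))
      ≤ χ * Real.exp (-(ε / 2)) ^ (s - (χ - 1)) := by
        gcongr
        linarith [Real.add_one_le_exp (-(ε / 2))]
    _ ≤ χ * Real.exp (-(Real.log χ + c)) := by
        rw [← Real.exp_nat_mul]
        gcongr
        linarith
    _ = Real.exp (-c) := by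
        rw [neg_add, Real.exp_add, Real.exp_neg (Real.log χ), Real.exp_log hχ0]
        field_simp

/-- **The subgraph test** (Theorem 12). If the comparability graph `G` is `ε`-far from
being `K_χ`-free, then `⌈(4·log χ + 4c + 1)/(2ε)⌉` vertices chosen independently and
uniformly at random contain a copy of `K_χ` with probability at least `1 - e^{-c}`. -/
theorem subgraph_test {V : Type*} [Fintype V] (G : SimpleGraph V) (hG : IsComparability G)
    (χ : ℕ) (hχ : 2 ≤ χ) (ε c : ℝ) (hε : 0 < ε) (hc : 0 < c)
    (hfar : ∀ G' : SimpleGraph V, G' ≤ G →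
      (deletedEdges G G' : ℝ) ≤ ε * (Fintype.card V : ℝ) ^ 2 → ¬ G'.CliqueFree χ) :
    1 - Real.exp (-c) ≤
      (Nat.card {f : Fin ⌈(4 * Real.log χ + 4 * c + 1) / (2 * ε)⌉₊ → V //
          ∃ g : Fin χ → Fin ⌈(4 * Real.log χ + 4 * c + 1) / (2 * ε)⌉₊,
            ∀ i j : Fin χ, i ≠ j → G.Adj (f (g i)) (f (g j))} : ℝ) /
        (Fintype.card V : ℝ) ^ (⌈(4 * Real.log χ + 4 * c + 1) / (2 * ε)⌉₊ : ℕ) := by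
  classical
  obtain ⟨r, ⟨hirr, htr⟩, hadj⟩ := hG
  set s := ⌈(4 * Real.log χ + 4 * c + 1) / (2 * ε)⌉₊ with hs
  have hχ1 : 0 < χ - 1 := by omega
  have hn : 0 < Fintype.card V := by
    rw [Fintype.card_pos_iff]
    by_contra hV
    rw [not_nonempty_iff] at hV
    have hcf : (⊥ : SimpleGraph V).CliqueFree χ :=
      SimpleGraph.cliqueFree_bot hχ
    refine hfar ⊥ bot_le ?_ hcf
    simp [deletedEdges]
  have hn' : (0 : ℝ) < Fintype.card V := by exact_mod_cast hn
  have hnot : ∀ G' ≤ G, G'.Colorable (χ - 1) →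
      ε * (Fintype.card V : ℝ) ^ 2 < deletedEdges G G' := fun G' hle hcol =>
    lt_of_not_ge fun h => hfar G' hle h (hcol.cliqueFree (by omega))
  have hχε : 2 * ε * ((χ - 1 : ℕ) : ℝ) ≤ 1 := by
    obtain ⟨G', hle, hcol, hdel⟩ := exists_colorable_deletedEdges_le G hχ1
    have h := (hnot G' hle hcol).trans_le hdel
    have hm : (0 : ℝ) < ((χ - 1 : ℕ) : ℝ) := by exact_mod_cast hχ1
    rw [lt_div_iff₀ (by positivity)] at h
    have hsq : (0 : ℝ) < (Fintype.card V : ℝ) ^ 2 := by positivity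
    by_contra hcon
    nlinarith
  have hq0 : 0 ≤ 1 - ε / 2 := by
    have : (1 : ℝ) ≤ ((χ - 1 : ℕ) : ℝ) := by exact_mod_cast hχ1
    nlinarith
  have hd : (1 - (1 - ε / 2)) * (Fintype.card V : ℝ) = ε / 2 * Fintype.card V := by ring
  have hL : (1 - (1 - ε / 2)) * (Fintype.card V : ℝ) ≤
      (robustLevel r ((1 - (1 - ε / 2)) * Fintype.card V) (χ - 1)).card := by
    by_contra hcon
    obtain ⟨G', hle, hcol, hdel⟩ :=
      exists_colorable_of_card_robustLevel_le htr hadj hχ1 (not_le.1 hcon).le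
    have h := (hnot G' hle hcol).trans_le hdel
    rw [hd] at h
    linarith
  let ρ : V → ℕ := fun v => (univ.filter fun u => r u v).card
  have hρ : ∀ x y, r x y → ρ x < ρ y := by
    intro x y hxy
    refine card_lt_card (ssubset_iff_of_subset (monotone_filter_right _
      fun u _ hu => htr hu hxy) |>.2 ⟨x, ?_, ?_⟩)
    · simpa using hxy
    · simpa using hirr x
  have hfail := card_no_chain_le (ρ := ρ) (ι := Fin s) htr hρ hq0 (by linarith) (χ - 1) univ
    (fun _ => univ) _ Subset.rfl hL (fun _ _ => subset_univ _) (fun _ _ _ _ _ _ => mem_univ _)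
  have hχcast : (((χ - 1 : ℕ) : ℝ) + 1) = χ := by exact_mod_cast (by omega : χ - 1 + 1 = χ)
  simp only [hχcast, card_univ, Fintype.card_fin, prod_const] at hfail
  have hbound := mul_pow_sample_le (c := c) hχ hε hq0 hχε (Nat.le_ceil _)
  rw [← hs] at hbound
  have hgood : ∀ f : Fin s → V,
      (∃ i, f i ∈ robustLevel r ((1 - (1 - ε / 2)) * Fintype.card V) (χ - 1) ∧
        HasChainBelow r f (χ - 1) (f i)) →
      ∃ g : Fin χ → Fin s, ∀ i j : Fin χ, i ≠ j → G.Adj (f (g i)) (f (g j)) := by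
    rintro f ⟨i₀, -, hi₀⟩
    obtain ⟨k, rfl⟩ : ∃ k, χ = k + 1 := ⟨χ - 1, by omega⟩
    obtain ⟨g, hg, hg'⟩ := hi₀.exists_chain htr
    have hlt : ∀ i j : Fin (k + 1), i < j →
        r (f ((Fin.cons i₀ g : Fin (k + 1) → Fin s) j))
          (f ((Fin.cons i₀ g : Fin (k + 1) → Fin s) i)) := by
      intro i j hij
      cases j using Fin.cases with
      | zero => exact absurd hij (Fin.not_lt_zero i)
      | succ j =>
        cases i using Fin.cases with
        | zero => simpa using hg j
        | succ i => simpa using hg' i j (by simpa using hij)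
    refine ⟨Fin.cons i₀ g, fun i j hij => (hadj _ _).2 ?_⟩
    rcases lt_or_gt_of_ne hij with h | h
    · exact Or.inr (hlt i j h)
    · exact Or.inl (hlt j i h)
  rw [le_div_iff₀ (by positivity), Nat.card_eq_fintype_card, Fintype.card_subtype]
  set A : Finset (Fin s → V) := univ.filter fun f =>
    ∃ g : Fin χ → Fin s, ∀ i j : Fin χ, i ≠ j → G.Adj (f (g i)) (f (g j)) with hA
  have hcard : (A.card : ℝ) + (Aᶜ.card : ℝ) = (Fintype.card V : ℝ) ^ s := by
    have := card_add_card_compl A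
    rw [Fintype.card_fun, Fintype.card_fin] at this
    exact_mod_cast this
  have hAc : (Aᶜ.card : ℝ) ≤ (Fintype.card V : ℝ) ^ s * Real.exp (-c) := by
    refine le_trans ?_ (hfail.trans (mul_le_mul_of_nonneg_left hbound (by positivity)))
    refine Nat.cast_le.2 (card_le_card fun f hf => ?_)
    simp only [mem_filter, Fintype.mem_piFinset, mem_univ, implies_true, true_and]
    intro h
    exact mem_compl.1 hf (mem_filter.2 ⟨mem_univ _, hgood f h⟩)
  linarith
end
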